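/- arXiv:2506.23710 — 7 statements merged into one kernel-verified Lean document; each statement's English description precedes it below -/
import Mathlib

section
/- The space F_2(L) of type 2 maps of a Lie superalgebra L is closed under the graded commutator [δ_1,δ_2] = δ_1 δ_2 − (-1)^{|δ_1||δ_2|} δ_2 δ_1, and hence forms a Lie superalgebra. Specifically, if δ_i corresponds to the superderivation D_i via δ_i(x) = (-1)^{|D_i||x|}D_i(x), then [δ_1,δ_2](x) = (-1)^{|D_1||D_2|}(-1)^{|[D_1,D_2]||x|}[D_1,D_2](x) for homogeneous x. -/
namespace SuperBider

/-- The sign `(-1)^{ab}` for `a b : ZMod 2`, valued in the field `F`. -/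
def sgn (F : Type*) [Field F] (a b : ZMod 2) : F := (-1) ^ (a * b).val

variable (F : Type*) [Field F] {L : Type*} [AddCommGroup L] [Module F L]
variable (grade : ZMod 2 → Submodule F L) (br : L →ₗ[F] L →ₗ[F] L)

/-- The bracket respects the `ZMod 2`-grading. -/
def GradedBr : Prop :=
  ∀ a b : ZMod 2, ∀ x ∈ grade a, ∀ y ∈ grade b, br x y ∈ grade (a + b)

/-- Super skew-symmetry: `[x,y] = -(-1)^{|x||y|}[y,x]`. -/
def SuperSkew : Prop :=
  ∀ a b : ZMod 2, ∀ x ∈ grade a, ∀ y ∈ grade b, br x y = -(sgn F a b) • br y x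

/-- Graded Jacobi identity (in the form `[x,[y,z]] = [[x,y],z] + (-1)^{|x||y|}[y,[x,z]]`). -/
def SuperJacobi : Prop :=
  ∀ a b c : ZMod 2, ∀ x ∈ grade a, ∀ y ∈ grade b, ∀ z ∈ grade c,
    br x (br y z) = br (br x y) z + (sgn F a b) • br y (br x z)

/-- `(L, grade, br)` is a Lie superalgebra: the grading is an internal direct sum
decomposition and the bracket is graded, super skew-symmetric and satisfies the
graded Jacobi identity. -/
def IsLieSuper : Prop :=
  DirectSum.IsInternal grade ∧ GradedBr F grade br ∧ SuperSkew F grade br ∧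
    SuperJacobi F grade br

/-- A homogeneous linear map of degree `d`. -/
def HomogMap (d : ZMod 2) (f : L →ₗ[F] L) : Prop :=
  ∀ i : ZMod 2, ∀ x ∈ grade i, f x ∈ grade (i + d)

/-- A superderivation (type 1 map) of degree `d`:
`D[x,y] = [Dx,y] + (-1)^{|D||x|}[x,Dy]`. -/
def IsSuperDer (d : ZMod 2) (D : L →ₗ[F] L) : Prop :=
  HomogMap F grade d D ∧ ∀ a b : ZMod 2, ∀ x ∈ grade a, ∀ y ∈ grade b,
    D (br x y) = br (D x) y + (sgn F d a) • br x (D y)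

/-- A type 2 map of degree `d`: `δ[x,y] = (-1)^{|δ||y|}[δx,y] + [x,δy]`. -/
def IsType2 (d : ZMod 2) (δ : L →ₗ[F] L) : Prop :=
  HomogMap F grade d δ ∧ ∀ a b : ZMod 2, ∀ x ∈ grade a, ∀ y ∈ grade b,
    δ (br x y) = (sgn F d b) • br (δ x) y + br x (δ y)

/-- The space `Der(L)` of superderivations: the span of homogeneous superderivations. -/
def DerS : Submodule F (L →ₗ[F] L) :=
  Submodule.span F {D | ∃ d : ZMod 2, IsSuperDer F grade br d D}

/-- The space `F₂(L)` of type 2 maps: the span of homogeneous type 2 maps. -/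
def F2S : Submodule F (L →ₗ[F] L) :=
  Submodule.span F {δ | ∃ d : ZMod 2, IsType2 F grade br d δ}

/-- A superbiderivation of degree `dB`. -/
def IsSuperBider (dB : ZMod 2) (B : L →ₗ[F] L →ₗ[F] L) : Prop :=
  (∀ a b : ZMod 2, ∀ x ∈ grade a, ∀ y ∈ grade b, B x y ∈ grade (a + b + dB)) ∧
  (∀ a b c : ZMod 2, ∀ x ∈ grade a, ∀ y ∈ grade b, ∀ z ∈ grade c,
    B x (br y z) = br (B x y) z + (sgn F (dB + a) b) • br y (B x z)) ∧
  (∀ a b c : ZMod 2, ∀ x ∈ grade a, ∀ y ∈ grade b, ∀ z ∈ grade c,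
    B (br x y) z = (sgn F (dB + c) b) • br (B x z) y + br x (B y z))

/-- The center of `L` is trivial. -/
def CenterTrivial : Prop := ∀ x : L, (∀ y : L, br x y = 0) → x = 0

end SuperBider

namespace SuperBider

variable {F : Type*} [Field F] {L : Type*} [AddCommGroup L] [Module F L]

theorem sgn_comm (a b : ZMod 2) : sgn F a b = sgn F b a := by
  simp only [sgn, mul_comm]

theorem sgn_add_right (a b c : ZMod 2) : sgn F a (b + c) = sgn F a b * sgn F a c := by
  rw [sgn, sgn, sgn, mul_add, ZMod.val_add, ← neg_one_pow_eq_pow_mod_two, pow_add]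

theorem sgn_add_left (a b c : ZMod 2) : sgn F (a + b) c = sgn F a c * sgn F b c := by
  simp only [sgn_comm _ c, sgn_add_right]

theorem sgn_mul_self (a b : ZMod 2) : sgn F a b * sgn F a b = 1 := by
  simp only [sgn, ← mul_pow, neg_mul_neg, one_mul, one_pow]

theorem HomogMap.gradedCommutator {grade : ZMod 2 → Submodule F L} {d₁ d₂ : ZMod 2}
    {f g : L →ₗ[F] L} (hf : HomogMap F grade d₁ f) (hg : HomogMap F grade d₂ g) (c : F) :
    HomogMap F grade (d₁ + d₂) (f ∘ₗ g - c • (g ∘ₗ f)) := by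
  intro i x hx
  have hfg := hf _ _ (hg i x hx)
  have hgf := hg _ _ (hf i x hx)
  rw [add_assoc, add_comm d₂] at hfg
  rw [add_assoc] at hgf
  exact sub_mem hfg (Submodule.smul_mem _ _ hgf)

theorem IsType2.gradedCommutator {grade : ZMod 2 → Submodule F L} {br : L →ₗ[F] L →ₗ[F] L}
    {d₁ d₂ : ZMod 2} {f g : L →ₗ[F] L}
    (hf : IsType2 F grade br d₁ f) (hg : IsType2 F grade br d₂ g) :
    IsType2 F grade br (d₁ + d₂) (f ∘ₗ g - (sgn F d₁ d₂) • (g ∘ₗ f)) := by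
  refine ⟨hf.1.gradedCommutator hg.1 _, fun a b x hx y hy => ?_⟩
  have hs := sgn_mul_self (F := F) d₁ d₂
  simp only [LinearMap.sub_apply, LinearMap.smul_apply, LinearMap.comp_apply, map_sub, map_smul,
    map_add, hf.2 a b x hx y hy, hg.2 a b x hx y hy,
    hf.2 _ _ _ (hg.1 a x hx) y hy, hf.2 _ _ x hx _ (hg.1 b y hy),
    hg.2 _ _ _ (hf.1 a x hx) y hy, hg.2 _ _ x hx _ (hf.1 b y hy),
    sgn_add_left, sgn_add_right, sgn_comm d₂ d₁]
  linear_combination (norm := module) (-sgn F d₂ b * hs) • br (g x) (f y)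

/-- `F₂(L)` is closed under the graded commutator, and under the
correspondence `δᵢ(x) = (-1)^{|Dᵢ||x|}Dᵢ(x)` one has
`[δ₁,δ₂](x) = (-1)^{|D₁||D₂|}(-1)^{|[D₁,D₂]||x|}[D₁,D₂](x)` on homogeneous `x`. -/
theorem typeTwo_gradedCommutator
    (grade : ZMod 2 → Submodule F L) (br : L →ₗ[F] L →ₗ[F] L)
    (hL : IsLieSuper F grade br) (h2 : (2 : F) ≠ 0)
    (d₁ d₂ : ZMod 2) (δ₁ δ₂ : L →ₗ[F] L)
    (hδ₁ : IsType2 F grade br d₁ δ₁) (hδ₂ : IsType2 F grade br d₂ δ₂)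
    (D₁ D₂ : L →ₗ[F] L)
    (hD₁ : IsSuperDer F grade br d₁ D₁) (hD₂ : IsSuperDer F grade br d₂ D₂)
    (hc₁ : ∀ i : ZMod 2, ∀ x ∈ grade i, δ₁ x = (sgn F d₁ i) • D₁ x)
    (hc₂ : ∀ i : ZMod 2, ∀ x ∈ grade i, δ₂ x = (sgn F d₂ i) • D₂ x) :
    IsType2 F grade br (d₁ + d₂) (δ₁ ∘ₗ δ₂ - (sgn F d₁ d₂) • (δ₂ ∘ₗ δ₁)) ∧
      ∀ i : ZMod 2, ∀ x ∈ grade i,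
        (δ₁ ∘ₗ δ₂ - (sgn F d₁ d₂) • (δ₂ ∘ₗ δ₁)) x
          = (sgn F d₁ d₂) • ((sgn F (d₁ + d₂) i) •
              ((D₁ ∘ₗ D₂ - (sgn F d₁ d₂) • (D₂ ∘ₗ D₁)) x)) := by
  refine ⟨hδ₁.gradedCommutator hδ₂, fun i x hx => ?_⟩
  simp only [LinearMap.sub_apply, LinearMap.smul_apply, LinearMap.comp_apply, map_smul,
    hc₁ i x hx, hc₂ i x hx, hc₁ _ _ (hD₂.1 i x hx), hc₂ _ _ (hD₁.1 i x hx),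
    sgn_add_left, sgn_add_right, sgn_comm d₂ d₁]
  module

end SuperBider
end

section
/- Let L be a complete Lie superalgebra and B a homogeneous bilinear map of degree |B|. Then B is a superbiderivation of L if and only if there exist homogeneous linear maps φ, ψ : L → L of degree |B| such that B(x,y) = [φ(x),y] = [x,ψ(y)] for all x,y ∈ L. -/
namespace SuperBider

variable {F : Type*} [Field F] {L : Type*} [AddCommGroup L] [Module F L]

section Grading

variable {grade : ZMod 2 → Submodule F L}

/-- Linear maps agreeing on homogeneous elements are equal. -/
theorem hom_ext_of_isInternal {M : Type*} [AddCommGroup M] [Module F M]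
    (hg : DirectSum.IsInternal grade) {f g : L →ₗ[F] M}
    (h : ∀ i, ∀ x ∈ grade i, f x = g x) : f = g := by
  ext x
  have hx : x ∈ ⨆ i, grade i := hg.submodule_iSup_eq_top ▸ Submodule.mem_top
  have hle : ⨆ i, grade i ≤ LinearMap.eqLocus f g := iSup_le h
  exact hle hx

/-- A family of scalars defines a linear map acting by these scalars on the components. -/
theorem exists_scaling (hg : DirectSum.IsInternal grade) (c : ZMod 2 → F) :
    ∃ T : L →ₗ[F] L, ∀ i, ∀ x ∈ grade i, T x = c i • x := by
  let e := LinearEquiv.ofBijective (DirectSum.coeLinearMap grade) hg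
  refine ⟨DirectSum.toModule F _ L (fun i => c i • (grade i).subtype) ∘ₗ e.symm.toLinearMap,
    fun i x hx => ?_⟩
  have he : e.symm x = DirectSum.lof F _ (fun i => grade i) i ⟨x, hx⟩ := by
    rw [LinearEquiv.symm_apply_eq]
    exact (DirectSum.coeLinearMap_lof grade i ⟨x, hx⟩).symm
  simp [he]

theorem eq_zero_of_mem_of_mem (hg : DirectSum.IsInternal grade) {i j : ZMod 2} (hij : i ≠ j)
    {x : L} (hi : x ∈ grade i) (hj : x ∈ grade j) : x = 0 :=
  Submodule.disjoint_def.1 (hg.submodule_iSupIndep.pairwiseDisjoint hij) x hi hj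

theorem exists_eq_add (hg : DirectSum.IsInternal grade) (e : ZMod 2) (x : L) :
    ∃ u ∈ grade e, ∃ v ∈ grade (e + 1), x = u + v := by
  have hx : x ∈ ⨆ i, grade i := hg.submodule_iSup_eq_top ▸ Submodule.mem_top
  have hcase : ∀ e i : ZMod 2, i = e ∨ i = e + 1 := by decide
  have hle : ⨆ i, grade i ≤ grade e ⊔ grade (e + 1) := iSup_le fun i => by
    rcases hcase e i with rfl | rfl
    exacts [le_sup_left, le_sup_right]
  obtain ⟨u, hu, v, hv, h⟩ := Submodule.mem_sup.1 (hle hx)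
  exact ⟨u, hu, v, hv, h.symm⟩

/-- If `f` is an injective graded pairing, an element acting homogeneously is homogeneous. -/
theorem mem_grade_of_homogMap (hg : DirectSum.IsInternal grade) {f : L →ₗ[F] L →ₗ[F] L}
    (hf : Function.Injective f) (hgr : GradedBr F grade f) {e : ZMod 2} {u : L}
    (hu : HomogMap F grade e (f u)) : u ∈ grade e := by
  obtain ⟨p, hp, q, hq, rfl⟩ := exists_eq_add hg e u
  have hq0 : f q = 0 := hom_ext_of_isInternal hg fun i y hy => by
    have h1 := hgr _ _ q hq y hy
    have h2 : f q y ∈ grade (i + e) := by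
      have h := sub_mem (hu i y hy) (add_comm e i ▸ hgr _ _ p hp y hy)
      simpa using h
    have hne : ∀ e i : ZMod 2, e + 1 + i ≠ i + e := by decide
    exact eq_zero_of_mem_of_mem hg (hne e i) h1 h2
  rw [hf (hq0.trans (map_zero f).symm), add_zero]
  exact hp

/-- A homogeneous pairing taking values pointwise in the range of an injective graded
pairing `f` factors through `f` by a homogeneous linear map. -/
theorem exists_homogMap_factor (hg : DirectSum.IsInternal grade) {f B : L →ₗ[F] L →ₗ[F] L}
    (hf : Function.Injective f) (hgr : GradedBr F grade f) {d : ZMod 2}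
    (hB : ∀ a, ∀ x ∈ grade a, HomogMap F grade (d + a) (B x))
    (hex : ∀ a, ∀ x ∈ grade a, ∃ u, B x = f u) :
    ∃ φ : L →ₗ[F] L, HomogMap F grade d φ ∧ ∀ x, B x = f (φ x) := by
  obtain ⟨g, hgf⟩ := f.exists_leftInverse_of_injective (LinearMap.ker_eq_bot.2 hf)
  have key : ∀ a, ∀ x ∈ grade a, B x = f (g (B x)) := fun a x hx => by
    obtain ⟨u, hu⟩ := hex a x hx
    rw [hu, ← LinearMap.comp_apply g f, hgf, LinearMap.id_apply]
  refine ⟨g ∘ₗ B, fun a x hx => mem_grade_of_homogMap hg hf hgr ?_, fun x => ?_⟩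
  · rw [LinearMap.comp_apply, ← key a x hx, add_comm]
    exact hB a x hx
  · exact LinearMap.congr_fun
      (hom_ext_of_isInternal hg (f := B) (g := f ∘ₗ g ∘ₗ B) key) x

variable {br : L →ₗ[F] L →ₗ[F] L}

theorem injective_of_centerTrivial (hZ : CenterTrivial F br) : Function.Injective br :=
  (injective_iff_map_eq_zero br).2 fun x hx => hZ x fun y => by simp [hx]

theorem injective_flip_of_centerTrivial (hL : IsLieSuper F grade br) (hZ : CenterTrivial F br) :
    Function.Injective br.flip := by
  obtain ⟨hg, hgr, hsk, -⟩ := hL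
  refine (injective_iff_map_eq_zero br.flip).2 fun x hx => ?_
  obtain ⟨u, hu, v, hv, rfl⟩ := exists_eq_add hg 0 x
  have hleft : ∀ e, ∀ w ∈ grade e, (∀ i, ∀ y ∈ grade i, br y w = 0) → w = 0 := by
    intro e w hw h
    refine hZ w (LinearMap.congr_fun (f := br w) (g := 0) ?_)
    refine hom_ext_of_isInternal hg fun i y hy => ?_
    rw [hsk e i w hw y hy, h i y hy, smul_zero, LinearMap.zero_apply]
  have hsum : ∀ y, br y u + br y v = 0 := fun y => by
    simpa using LinearMap.congr_fun hx y
  have hne : ∀ i : ZMod 2, i + 0 ≠ i + (0 + 1) := by decide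
  have hu0 : u = 0 := hleft _ u hu fun i y hy => by
    refine eq_zero_of_mem_of_mem hg (hne i) (hgr _ _ y hy u hu) ?_
    rw [eq_neg_of_add_eq_zero_left (hsum y)]
    exact neg_mem (hgr _ _ y hy v hv)
  have hv0 : v = 0 := hleft _ v hv fun i y hy => by
    simpa [hu0] using hsum y
  rw [hu0, hv0, add_zero]

/-- If all superderivations are inner, every type 2 map is a right multiplication. -/
theorem IsType2.exists_eq_flip (hL : IsLieSuper F grade br) (hZ : CenterTrivial F br)
    (hinner : ∀ (d : ZMod 2) (D : L →ₗ[F] L), IsSuperDer F grade br d D → ∃ x : L, D = br x)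
    {d : ZMod 2} {δ : L →ₗ[F] L} (hδ : IsType2 F grade br d δ) : ∃ w, δ = br.flip w := by
  obtain ⟨hg, hgr, hsk, -⟩ := hL
  obtain ⟨hhom, hder⟩ := hδ
  obtain ⟨T, hT⟩ := exists_scaling hg fun i => -sgn F d i
  have hD : IsSuperDer F grade br d (δ ∘ₗ T) := by
    refine ⟨fun i x hx => ?_, fun a b x hx y hy => ?_⟩
    · rw [LinearMap.comp_apply, hT i x hx, map_smul]
      exact Submodule.smul_mem _ _ (hhom i x hx)
    · simp only [LinearMap.comp_apply, hT _ _ (hgr a b x hx y hy), hT a x hx, hT b y hy,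
        map_smul, hder a b x hx y hy, sgn_add_right, LinearMap.smul_apply]
      have h := sgn_mul_self (F := F) d b
      match_scalars
      · linear_combination (-sgn F d a) * h
      · ring
  obtain ⟨w, hw⟩ := hinner d _ hD
  have hwd : w ∈ grade d :=
    mem_grade_of_homogMap hg (injective_of_centerTrivial hZ) hgr (hw ▸ hD.1)
  refine ⟨w, hom_ext_of_isInternal hg fun i x hx => ?_⟩
  have hwx : -sgn F d i • δ x = br w x := by
    rw [← hw, LinearMap.comp_apply, hT i x hx, map_smul]
  rw [LinearMap.flip_apply, hsk i d x hx w hwd, ← hwx, sgn_comm i d, smul_smul, neg_mul_neg,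
    sgn_mul_self, one_smul]

end Grading

/-- for a complete Lie superalgebra `L`, a homogeneous bilinear map `B` of
degree `dB` is a superbiderivation iff there are homogeneous linear maps `φ, ψ` of degree
`dB` with `B(x,y) = [φ(x),y] = [x,ψ(y)]` for all `x, y`. -/
theorem superBider_iff_pair_of_complete
    (grade : ZMod 2 → Submodule F L) (br : L →ₗ[F] L →ₗ[F] L)
    (hL : IsLieSuper F grade br) (h2 : (2 : F) ≠ 0)
    (hZ : CenterTrivial F br)
    (hinner : ∀ (d : ZMod 2) (D : L →ₗ[F] L), IsSuperDer F grade br d D →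
      ∃ x : L, D = br x)
    (dB : ZMod 2) (B : L →ₗ[F] L →ₗ[F] L) :
    IsSuperBider F grade br dB B ↔
      ∃ φ ψ : L →ₗ[F] L, HomogMap F grade dB φ ∧ HomogMap F grade dB ψ ∧
        ∀ x y : L, B x y = br (φ x) y ∧ B x y = br x (ψ y) := by
  constructor
  · rintro ⟨hB, hB1, hB2⟩
    obtain ⟨hg, hgr, -, -⟩ := id hL
    have hhom : ∀ a, ∀ x ∈ grade a, HomogMap F grade (dB + a) (B x) := fun a x hx b y hy => by
      have h := hB a b x hx y hy
      rwa [show a + b + dB = b + (dB + a) by ring] at h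
    have hhom' : ∀ b, ∀ y ∈ grade b, HomogMap F grade (dB + b) (B.flip y) :=
      fun b y hy a x hx => by
        have h := hB a b x hx y hy
        rwa [show a + b + dB = a + (dB + b) by ring] at h
    obtain ⟨φ, hφ, hφB⟩ := exists_homogMap_factor hg (injective_of_centerTrivial hZ) hgr hhom
      fun a x hx => hinner (dB + a) (B x) ⟨hhom a x hx, fun b c y hy z hz =>
        hB1 a b c x hx y hy z hz⟩
    have hgr' : GradedBr F grade br.flip := fun a b x hx y hy =>
      add_comm b a ▸ hgr b a y hy x hx
    obtain ⟨ψ, hψ, hψB⟩ := exists_homogMap_factor hg (injective_flip_of_centerTrivial hL hZ)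
      hgr' hhom' fun c z hz => IsType2.exists_eq_flip hL hZ hinner (d := dB + c)
        ⟨hhom' c z hz, fun a b x hx y hy => hB2 a b c x hx y hy z hz⟩
    exact ⟨φ, ψ, hφ, hψ, fun x y =>
      ⟨LinearMap.congr_fun (hφB x) y, LinearMap.congr_fun (hψB y) x⟩⟩
  · rintro ⟨φ, ψ, hφ, hψ, h⟩
    obtain ⟨-, hgr, hsk, hJ⟩ := hL
    refine ⟨fun a b x hx y hy => ?_, fun a b c x hx y hy z hz => ?_,
      fun a b c x hx y hy z hz => ?_⟩
    · rw [(h x y).1, show a + b + dB = a + dB + b by ring]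
      exact hgr _ _ _ (hφ a x hx) y hy
    · rw [(h _ _).1, (h _ _).1, (h _ _).1, add_comm dB a]
      exact hJ _ _ _ _ (hφ a x hx) y hy z hz
    · have hz' := hψ c z hz
      rw [(h _ _).2, (h _ _).2, (h _ _).2, hJ a b (c + dB) x hx y hy _ hz',
        hsk b (a + (c + dB)) y hy _ (hgr _ _ x hx _ hz'), sgn_add_right, sgn_comm b a,
        sgn_comm b (c + dB), add_comm c dB]
      have hs := sgn_mul_self (F := F) a b
      match_scalars
      · ring
      · linear_combination sgn F (dB + c) b * hs

end SuperBider
end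

section
/- Let L be the (1|1)-dimensional Lie superalgebra with L_0 = span{x}, L_1 = span{v}, and only nonzero bracket [v,v] = x. A homogeneous bilinear map B of degree 1 on L is a superbiderivation (in the sense that B(a,−) is a superderivation and B(−,a) is a type 2 map) if and only if B(x,x) = 0, B(x,v) = B(v,x) = 2δ·x, and B(v,v) = δ·v for some scalar δ. -/
namespace SuperBider

variable (F : Type*) [Field F]

/-- The (1|1)-dimensional superalgebra `L = ⟨x⟩ ⊕ ⟨v⟩` modelled on `F × F`,
with `x = (1,0)` even, `v = (0,1)` odd. Grading: even part = ker of 2nd projection,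
odd part = ker of 1st projection. -/
def grade2 : ZMod 2 → Submodule F (F × F) := fun i =>
  if i = 0 then LinearMap.ker (LinearMap.snd F F F) else LinearMap.ker (LinearMap.fst F F F)

/-- The bracket on `F × F` determined by `[v,v] = x`, i.e. `[(a,b),(c,d)] = (bd, 0)`. -/
def br2 : (F × F) →ₗ[F] (F × F) →ₗ[F] (F × F) :=
  LinearMap.mk₂ F (fun p q => (p.2 * q.2, 0))
    (fun p p' q => by simp [Prod.ext_iff, add_mul])
    (fun c p q => by simp [Prod.ext_iff, mul_assoc])
    (fun p q q' => by simp [Prod.ext_iff, mul_add])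
    (fun c p q => by simp [Prod.ext_iff]; ring)

theorem zmod_two_cases (a : ZMod 2) : a = 0 ∨ a = 1 := by
  decide +revert

/-- A bilinear map on `F × F` with the prescribed basis values, in coordinates. -/
theorem apply_eq_of_basis {B : (F × F) →ₗ[F] (F × F) →ₗ[F] (F × F)} {d : F}
    (hxx : B (1, 0) (1, 0) = 0) (hxv : B (1, 0) (0, 1) = (2 * d, 0))
    (hvx : B (0, 1) (1, 0) = (2 * d, 0)) (hvv : B (0, 1) (0, 1) = (0, d)) (p q : F × F) :
    B p q = (2 * d * (p.1 * q.2 + p.2 * q.1), d * (p.2 * q.2)) := by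
  have decomp (r : F × F) : r = r.1 • ((1, 0) : F × F) + r.2 • ((0, 1) : F × F) := by
    simp
  conv_lhs => rw [decomp p, decomp q]
  simp only [map_add, map_smul, LinearMap.add_apply, LinearMap.smul_apply, hxx, hxv, hvx, hvv]
  ext <;> simp <;> ring

/-- a homogeneous bilinear map `B` of degree `1` on the superalgebra with
basis `x` (even), `v` (odd) and `[v,v] = x` is a superbiderivation iff
`B(x,x) = 0`, `B(x,v) = B(v,x) = 2δ·x` and `B(v,v) = δ·v` for some scalar `δ`. -/
theorem superBider_degOne_twoDim
    (h2 : (2 : F) ≠ 0)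
    (B : (F × F) →ₗ[F] (F × F) →ₗ[F] (F × F)) :
    IsSuperBider F (grade2 F) (br2 F) 1 B ↔
      ∃ d : F,
        B (1, 0) (1, 0) = 0 ∧
        B (1, 0) (0, 1) = (2 * d, 0) ∧
        B (0, 1) (1, 0) = (2 * d, 0) ∧
        B (0, 1) (0, 1) = (0, d) := by
  constructor
  · rintro ⟨hg, hder, htype⟩
    have hx : ((1, 0) : F × F) ∈ grade2 F 0 := by simp [grade2]
    have hv : ((0, 1) : F × F) ∈ grade2 F 1 := by simp [grade2]
    have hvv : (B (0, 1) (0, 1)).1 = 0 := by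
      simpa [grade2, show (1 + 1 + 1 : ZMod 2) = 1 from rfl] using hg 1 1 _ hv _ hv
    have hxv : (B (1, 0) (0, 1)).2 = 0 := by
      simpa [grade2, show (0 + 1 + 1 : ZMod 2) = 0 from rfl,
        show (1 + 1 : ZMod 2) = 0 from rfl] using hg 0 1 _ hx _ hv
    have hbr : br2 F (0, 1) (0, 1) = (1, 0) := by simp [br2]
    have hxx := hder 0 1 1 _ hx _ hv _ hv
    have hvx := hder 1 1 1 _ hv _ hv _ hv
    have hxv' := htype 1 1 1 _ hv _ hv _ hv
    rw [hbr] at hxx hvx hxv'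
    refine ⟨(B (0, 1) (0, 1)).2, ?_, ?_, ?_, ?_⟩
    · rw [hxx]
      simp [br2, hxv]
    · rw [hxv']
      simp [br2, sgn, show (1 + 1 : ZMod 2) = 0 from rfl, two_mul]
    · rw [hvx]
      simp [br2, sgn, show (1 + 1 : ZMod 2) = 0 from rfl, two_mul]
    · exact Prod.ext hvv rfl
  · rintro ⟨d, hxx, hxv, hvx, hvv⟩
    have hB := apply_eq_of_basis F hxx hxv hvx hvv
    refine ⟨?_, ?_, ?_⟩
    · intro a b p hp q hq
      rw [hB]
      rcases zmod_two_cases a with rfl | rfl <;> rcases zmod_two_cases b with rfl | rfl <;>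
        simp_all [grade2, show (1 + 1 : ZMod 2) = 0 from rfl]
    · intro a b c p hp q hq r hr
      simp only [hB]
      rcases zmod_two_cases a with rfl | rfl <;> rcases zmod_two_cases b with rfl | rfl <;>
        simp_all [grade2, br2, sgn, show (1 + 1 : ZMod 2) = 0 from rfl]
      ring
    · intro a b c p hp q hq r hr
      simp only [hB]
      rcases zmod_two_cases b with rfl | rfl <;> rcases zmod_two_cases c with rfl | rfl <;>
        simp_all [grade2, br2, sgn, show (1 + 1 : ZMod 2) = 0 from rfl]
      ring

end SuperBider
end

section
/- Let L be the (n+1)-dimensional Heisenberg Lie superalgebra with even part L_0 = span{c} and odd part L_1 = span{x_1,...,x_n}, with brackets [x_i,x_j] = δ_{ij} c. Every even superderivation of L, written as a matrix with respect to the basis {x_1,...,x_n,c}, has the form of a block diagonal matrix diag(A, λ) where A is an n×n matrix with A + A^t = λ I_n (i.e., A = (λ/2)I_n + B with B skew-symmetric). -/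
namespace SuperBider

open Matrix

variable (n : ℕ)

/-- The `(n+1)`-dimensional Heisenberg superalgebra modelled on `(Fin n → ℂ) × ℂ`:
`x_i = (e_i, 0)` odd, `c = (0,1)` even. Even part = ker of 1st projection,
odd part = ker of 2nd projection. -/
noncomputable def gradeH : ZMod 2 → Submodule ℂ ((Fin n → ℂ) × ℂ) := fun i =>
  if i = 0 then LinearMap.ker (LinearMap.fst ℂ (Fin n → ℂ) ℂ)
  else LinearMap.ker (LinearMap.snd ℂ (Fin n → ℂ) ℂ)

/-- The Heisenberg bracket `[(u,a),(w,b)] = (0, u ⬝ᵥ w)`, i.e. `[x_i, x_j] = δ_{ij} c`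
and `c` central. -/
noncomputable def brH : ((Fin n → ℂ) × ℂ) →ₗ[ℂ] ((Fin n → ℂ) × ℂ) →ₗ[ℂ] ((Fin n → ℂ) × ℂ) :=
  LinearMap.mk₂ ℂ (fun p q => ((0 : Fin n → ℂ), p.1 ⬝ᵥ q.1))
    (fun p p' q => by simp [Prod.ext_iff, add_dotProduct])
    (fun c p q => by simp [Prod.ext_iff, smul_dotProduct])
    (fun p q q' => by simp [Prod.ext_iff, dotProduct_add])
    (fun c p q => by simp [Prod.ext_iff, dotProduct_smul])

/-- every even superderivation `D` of the Heisenberg superalgebra is given,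
in the basis `{x_1,…,x_n,c}`, by a block matrix `diag(A, λ)` with `A + Aᵀ = λ·I`. -/
theorem even_superDer_heisenberg
    (D : ((Fin n → ℂ) × ℂ) →ₗ[ℂ] ((Fin n → ℂ) × ℂ))
    (hD : IsSuperDer ℂ (gradeH n) (brH n) 0 D) :
    ∃ (A : Matrix (Fin n) (Fin n) ℂ) (lam : ℂ),
      A + Aᵀ = lam • (1 : Matrix (Fin n) (Fin n) ℂ) ∧
      ∀ p : (Fin n → ℂ) × ℂ, D p = (A.mulVec p.1, lam * p.2) := by
  obtain ⟨hdeg, hder⟩ := hD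
  have heven (b : ℂ) : (D (0, b)).1 = 0 := by
    simpa [gradeH] using hdeg 0 (0, b) (by simp [gradeH])
  have hodd (u : Fin n → ℂ) : (D (u, 0)).2 = 0 := by
    simpa [gradeH] using hdeg 1 (u, 0) (by simp [gradeH])
  have hscal (b : ℂ) : (D (0, b)).2 = (D (0, 1)).2 * b := by
    have h : ((0 : Fin n → ℂ), b) = b • ((0 : Fin n → ℂ), (1 : ℂ)) := by simp
    rw [h, map_smul, Prod.smul_snd, smul_eq_mul, mul_comm]
  refine ⟨LinearMap.toMatrix' (LinearMap.fst ℂ _ _ ∘ₗ D ∘ₗ LinearMap.inl ℂ _ _),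
    (D (0, 1)).2, ?_, fun p => ?_⟩
  · ext i j
    have h := (hscal _).symm.trans (congrArg Prod.snd (hder 1 1 (Pi.single i 1, 0)
      (by simp [gradeH]) (Pi.single j 1, 0) (by simp [gradeH])))
    simp only [brH, LinearMap.mk₂_apply, sgn, ZMod.val_zero, pow_zero, one_smul,
      Prod.snd_add, single_dotProduct, dotProduct_single, one_mul, mul_one] at h
    simp only [Matrix.add_apply, Matrix.transpose_apply, Matrix.smul_apply, smul_eq_mul,
      LinearMap.toMatrix'_apply, LinearMap.comp_apply, LinearMap.inl_apply, LinearMap.fst_apply,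
      Matrix.one_apply]
    rw [add_comm, Pi.single_apply] at h
    simpa [eq_comm (a := i)] using h.symm
  · rw [← Matrix.toLin'_apply, Matrix.toLin'_toMatrix']
    have h : D p = D (p.1, 0) + D (0, p.2) := by rw [← map_add]; simp
    rw [h]
    ext1
    · simp [heven]
    · simp [hodd, hscal p.2]

end SuperBider
end

section
/- Let G = Der(L) be the superderivation algebra of the (n+1)-dimensional Heisenberg superalgebra with n ≥ 3, spanned by A, B_{ij} (i≠j, even elements) and C_i (odd elements) with brackets [A,C_i] = C_i, [B_{ij},B_{kl}] = δ_{jk}B_{il} + δ_{il}B_{jk} + δ_{jl}B_{ki} + δ_{ki}B_{lj}, [B_{ij},C_k] = δ_{kj}C_i − δ_{ki}C_j, [A,B_{ij}] = 0, [C_i,C_j] = 0. If φ, ψ : G → G are homogeneous linear maps of degree 0 satisfying [φ(x),y] = [x,ψ(y)] for all x,y ∈ G, then there exists a scalar λ such that φ = λ·id and ψ = λ·id. -/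
namespace SuperBider

open Matrix

variable (n : ℕ)

/-- The submodule of skew-symmetric `n × n` complex matrices (spanned by the
`B_{ij} = e_{ij} - e_{ji}`). -/
noncomputable def skewS : Submodule ℂ (Matrix (Fin n) (Fin n) ℂ) where
  carrier := {M | Mᵀ = -M}
  zero_mem' := by simp
  add_mem' := by
    intro M N hM hN
    simp only [Set.mem_setOf_eq] at *
    rw [Matrix.transpose_add, hM, hN, neg_add]
  smul_mem' := by
    intro c M hM
    simp only [Set.mem_setOf_eq] at *
    rw [Matrix.transpose_smul, hM, smul_neg]

/-- The superderivation algebra `G = Der(L)` of the `(n+1)`-dimensional Heisenberg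
superalgebra, modelled as `ℂ × skew matrices × ℂⁿ`: the even part is spanned by
`A = (1,0,0)` and the `B_{ij}` (skew matrices), the odd part by the `C_i = (0,0,e_i)`. -/
abbrev G := ℂ × skewS n × (Fin n → ℂ)

/-- The even part of `G`: third component zero. -/
noncomputable def evenG : Submodule ℂ (G n) where
  carrier := {p | p.2.2 = 0}
  zero_mem' := rfl
  add_mem' := by intro p q hp hq; simp only [Set.mem_setOf_eq] at *; simp [hp, hq]
  smul_mem' := by intro c p hp; simp only [Set.mem_setOf_eq] at *; simp [hp]

/-- The odd part of `G`: first two components zero. -/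
noncomputable def oddG : Submodule ℂ (G n) where
  carrier := {p | p.1 = 0 ∧ p.2.1 = 0}
  zero_mem' := ⟨rfl, rfl⟩
  add_mem' := by
    intro p q hp hq
    simp only [Set.mem_setOf_eq] at *
    exact ⟨by simp [hp.1, hq.1], by simp [hp.2, hq.2]⟩
  smul_mem' := by
    intro c p hp
    simp only [Set.mem_setOf_eq] at *
    exact ⟨by simp [hp.1], by simp [hp.2]⟩

/-- The grading of `G`. -/
noncomputable def gradeG : ZMod 2 → Submodule ℂ (G n) := fun i => if i = 0 then evenG n else oddG n

/-- The bracket of `G`, encoding `[A,C_i] = C_i`, `[B_{ij},B_{kl}] =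
δ_{jk}B_{il} + δ_{il}B_{jk} + δ_{jl}B_{ki} + δ_{ki}B_{lj}` (the matrix commutator),
`[B_{ij},C_k] = δ_{kj}C_i - δ_{ki}C_j` (matrix action on vectors), `[A,B_{ij}] = 0`,
`[C_i,C_j] = 0`. -/
noncomputable def brG (p q : G n) : G n :=
  ⟨0,
   ⟨p.2.1.1 * q.2.1.1 - q.2.1.1 * p.2.1.1, by
      have hp : (p.2.1.1)ᵀ = -p.2.1.1 := p.2.1.2
      have hq : (q.2.1.1)ᵀ = -q.2.1.1 := q.2.1.2
      show (p.2.1.1 * q.2.1.1 - q.2.1.1 * p.2.1.1)ᵀ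
          = -(p.2.1.1 * q.2.1.1 - q.2.1.1 * p.2.1.1)
      rw [Matrix.transpose_sub, Matrix.transpose_mul, Matrix.transpose_mul, hp, hq,
        neg_mul_neg, neg_mul_neg, neg_sub]⟩,
   p.1 • q.2.2 - q.1 • p.2.2 + p.2.1.1.mulVec q.2.2 - q.2.1.1.mulVec p.2.2⟩

theorem smul_one_add_skew_eq_zero (hn : 3 ≤ n) {a : ℂ} {Y : Matrix (Fin n) (Fin n) ℂ}
    (hY : Yᵀ = -Y) (h : a • (1 : Matrix (Fin n) (Fin n) ℂ) + Y = 0) : a = 0 ∧ Y = 0 := by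
  have ha : a = 0 := by
    have h0 := congrFun (congrFun h ⟨0, by omega⟩) ⟨0, by omega⟩
    have h1 := congrFun (congrFun hY ⟨0, by omega⟩) ⟨0, by omega⟩
    simp only [Matrix.add_apply, Matrix.smul_apply, Matrix.one_apply_eq, Matrix.zero_apply,
      Matrix.transpose_apply, Matrix.neg_apply, smul_eq_mul] at h0 h1
    linear_combination h0 - h1 / 2
  exact ⟨ha, by simpa [ha] using h⟩

theorem single_sub_single_mem_skewS (i j : Fin n) :
    Matrix.single i j (1 : ℂ) - Matrix.single j i 1 ∈ skewS n := by
  change (Matrix.single i j (1 : ℂ) - Matrix.single j i 1)ᵀ = -_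
  simp

/-- A skew matrix whose products with all skew matrices are scalar plus skew vanishes. -/
theorem skew_eq_zero_of_forall_mul (hn : 3 ≤ n) {S : Matrix (Fin n) (Fin n) ℂ} (hS : Sᵀ = -S)
    (h : ∀ X ∈ skewS n, ∃ a : ℂ, ∃ Y ∈ skewS n, a • (1 : Matrix (Fin n) (Fin n) ℂ) + Y = X * S) :
    S = 0 := by
  ext j k
  rcases eq_or_ne j k with rfl | hjk
  · have := congrFun (congrFun hS j) j
    simp only [Matrix.transpose_apply, Matrix.neg_apply] at this
    simpa using self_eq_neg.mp this
  · obtain ⟨i, hi⟩ : ∃ i, i ∉ ({j, k} : Finset (Fin n)) := by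
      by_contra! hall
      have h1 := Finset.card_le_card (fun x _ => hall x : Finset.univ ⊆ {j, k})
      have h2 := Finset.card_le_two (a := j) (b := k)
      simp only [Finset.card_univ, Fintype.card_fin] at h1
      omega
    simp only [Finset.mem_insert, Finset.mem_singleton, not_or] at hi
    obtain ⟨a, Y, hY, e⟩ := h _ (single_sub_single_mem_skewS n i j)
    have hY' := congrFun (congrFun (show Yᵀ = -Y from hY) i) k
    have e1 := congrFun (congrFun e i) k
    have e2 := congrFun (congrFun e k) i
    simp [Matrix.sub_mul, hi.1, hi.2, Ne.symm hi.2, hjk.symm, Matrix.single_mul_apply_of_ne]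
      at e1 e2 hY'
    change S j k = 0
    linear_combination hY' - e2 - e1

theorem brG_swap (p q : G n) : brG n q p = -brG n p q := by
  refine Prod.ext ?_ (Prod.ext (Subtype.ext ?_) ?_) <;> simp [brG]
  abel

/-- On a pair of even maps intertwined by the bracket, the first is scalar on the even part and
the second is the same scalar on the odd part. -/
theorem exists_scalar_even_odd (hn : 3 ≤ n) (φ ψ : G n →ₗ[ℂ] G n)
    (hφ : ∀ i : ZMod 2, ∀ p ∈ gradeG n i, φ p ∈ gradeG n i)
    (hψ : ∀ i : ZMod 2, ∀ p ∈ gradeG n i, ψ p ∈ gradeG n i)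
    (h : ∀ p q : G n, brG n (φ p) q = brG n p (ψ q)) :
    ∃ lam : ℂ, (∀ p ∈ evenG n, φ p = lam • p) ∧ ∀ p ∈ oddG n, ψ p = lam • p := by
  have hφe : ∀ p ∈ evenG n, (φ p).2.2 = 0 := fun p hp => hφ 0 p hp
  have hψo : ∀ p ∈ oddG n, (ψ p).1 = 0 ∧ (ψ p).2.1 = 0 := fun p hp => hψ 1 p hp
  have key : ∀ p ∈ evenG n, ∀ v : Fin n → ℂ,
      (φ p).1 • v + (φ p).2.1.1 *ᵥ v =
        p.1 • (ψ (0, 0, v)).2.2 + p.2.1.1 *ᵥ (ψ (0, 0, v)).2.2 := by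
    intro p hp v
    have e := congrArg (fun x : G n => x.2.2) (h p (0, 0, v))
    have ho := hψo (0, 0, v) ⟨rfl, rfl⟩
    have hp' : p.2.2 = 0 := hp
    simpa [brG, hφe p hp, ho.1, ho.2, hp'] using e
  obtain ⟨lam, S, hS, hQ⟩ : ∃ lam : ℂ, ∃ S : Matrix (Fin n) (Fin n) ℂ, Sᵀ = -S ∧
      ∀ v, (ψ (0, 0, v)).2.2 = lam • v + S *ᵥ v := by
    refine ⟨(φ (1, 0, 0)).1, (φ (1, 0, 0)).2.1.1, (φ (1, 0, 0)).2.1.2, fun v => ?_⟩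
    simpa using (key (1, 0, 0) rfl v).symm
  have mat : ∀ p ∈ evenG n, (φ p).1 • (1 : Matrix (Fin n) (Fin n) ℂ) + (φ p).2.1.1 =
      (p.1 • (1 : Matrix (Fin n) (Fin n) ℂ) + p.2.1.1) * (lam • 1 + S) := by
    intro p hp
    refine Matrix.ext_of_mulVec_single fun i => ?_
    have e := key p hp (Pi.single i 1)
    rw [hQ] at e
    simp only [← Matrix.mulVec_mulVec, Matrix.add_mulVec, Matrix.smul_mulVec, Matrix.one_mulVec]
    exact e
  have hS0 : S = 0 := by
    refine skew_eq_zero_of_forall_mul n hn hS fun X hX => ?_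
    refine ⟨(φ (0, ⟨X, hX⟩, 0)).1, (φ (0, ⟨X, hX⟩, 0)).2.1.1 - lam • X,
      sub_mem (φ (0, ⟨X, hX⟩, 0)).2.1.2 ((skewS n).smul_mem lam hX), ?_⟩
    have e := mat (0, ⟨X, hX⟩, 0) rfl
    simp only [zero_smul, zero_add, Matrix.mul_add, Matrix.mul_smul, Matrix.mul_one] at e
    rw [← add_sub_assoc, e]
    abel
  refine ⟨lam, fun p hp => ?_, fun p hp => ?_⟩
  · have e := mat p hp
    obtain ⟨h1, h2⟩ := smul_one_add_skew_eq_zero n hn (a := (φ p).1 - lam * p.1)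
      (Y := (φ p).2.1.1 - lam • p.2.1.1)
      (sub_mem (φ p).2.1.2 ((skewS n).smul_mem lam p.2.1.2)) (by
        simp only [hS0, add_zero, Matrix.mul_smul, Matrix.mul_one, smul_add, smul_smul] at e
        rw [sub_smul, sub_add_sub_comm, e, sub_self])
    have hp' : p.2.2 = 0 := hp
    refine Prod.ext ?_ (Prod.ext (Subtype.ext ?_) ?_)
    · exact sub_eq_zero.mp h1
    · exact sub_eq_zero.mp h2
    · simp [hφe p hp, hp']
  · obtain ⟨a, X, v⟩ := p
    obtain ⟨rfl, rfl⟩ : a = 0 ∧ X = 0 := hp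
    have ho := hψo (0, 0, v) ⟨rfl, rfl⟩
    refine Prod.ext ?_ (Prod.ext ?_ ?_)
    · simp [ho.1]
    · simp [ho.2]
    · simp [hQ, hS0]

/-- if `φ, ψ` are homogeneous linear maps of degree `0` on `G` (n ≥ 3)
with `[φ(x),y] = [x,ψ(y)]` for all `x,y`, then `φ = ψ = λ·id` for some `λ ∈ ℂ`. -/
theorem degZero_pair_scalar (hn : 3 ≤ n)
    (φ ψ : G n →ₗ[ℂ] G n)
    (hφ : ∀ i : ZMod 2, ∀ p ∈ gradeG n i, φ p ∈ gradeG n i)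
    (hψ : ∀ i : ZMod 2, ∀ p ∈ gradeG n i, ψ p ∈ gradeG n i)
    (h : ∀ p q : G n, brG n (φ p) q = brG n p (ψ q)) :
    ∃ lam : ℂ, φ = lam • (LinearMap.id : G n →ₗ[ℂ] G n) ∧
      ψ = lam • (LinearMap.id : G n →ₗ[ℂ] G n) := by
  obtain ⟨lam, hφe, hψo⟩ := exists_scalar_even_odd n hn φ ψ hφ hψ h
  obtain ⟨mu, hψe, hφo⟩ := exists_scalar_even_odd n hn ψ φ hψ hφ fun p q => by
    rw [brG_swap, ← h, ← brG_swap]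
  have hlm : lam = mu := by
    let i : Fin n := ⟨0, by omega⟩
    let j : Fin n := ⟨1, by omega⟩
    let k : Fin n := ⟨2, by omega⟩
    have hij : i ≠ j := by simp [i, j]
    have hik : i ≠ k := by simp [i, k]
    have hjk : j ≠ k := by simp [j, k]
    have e := h (0, ⟨_, single_sub_single_mem_skewS n i j⟩, 0)
      (0, ⟨_, single_sub_single_mem_skewS n j k⟩, 0)
    rw [hφe _ rfl, hψe _ rfl] at e
    have e' := congrArg (fun x : G n => x.2.1.1 i k) e
    simpa [brG, Matrix.sub_mul, Matrix.mul_sub, Matrix.single_mul_single_of_ne, hij, hik, hjk,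
      hij.symm, hik.symm, hjk.symm] using e'
  subst hlm
  have split : ∀ p : G n, p = (p.1, p.2.1, 0) + (0, 0, p.2.2) := fun p => by simp
  refine ⟨lam, LinearMap.ext fun p => ?_, LinearMap.ext fun p => ?_⟩
  · rw [split p, map_add, hφe (p.1, p.2.1, 0) rfl, hφo (0, 0, p.2.2) ⟨rfl, rfl⟩, ← smul_add]
    rfl
  · rw [split p, map_add, hψe (p.1, p.2.1, 0) rfl, hψo (0, 0, p.2.2) ⟨rfl, rfl⟩, ← smul_add]
    rfl

end SuperBider
end

section
/- Let G be the superderivation algebra of the (n+1)-dimensional Heisenberg superalgebra with n ≥ 3. Every superbiderivation F of G has degree 0 and is of the form F(x,y) = λ[x,y] for some scalar λ and all x,y ∈ G. -/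
namespace SuperBider

open Matrix

variable (n : ℕ)

section Bracket

variable {n}

theorem G_ext {p q : G n} (h₁ : p.1 = q.1) (h₂ : p.2.1.1 = q.2.1.1) (h₃ : p.2.2 = q.2.2) :
    p = q :=
  Prod.ext h₁ (Prod.ext (Subtype.ext h₂) h₃)

theorem brG_add_left (p p' q : G n) : brG n (p + p') q = brG n p q + brG n p' q := by
  refine G_ext ?_ ?_ ?_ <;> simp [brG, add_mul, mul_add, add_smul, add_mulVec, mulVec_add] <;> abel

theorem brG_smul_left (c : ℂ) (p q : G n) : brG n (c • p) q = c • brG n p q := by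
  refine G_ext ?_ ?_ ?_
  · simp [brG]
  · simp [brG, smul_sub]
  · simp [brG, mulVec_smul, smul_mulVec, smul_sub, smul_add, smul_smul, mul_comm]

theorem brG_skew (p q : G n) : brG n p q = -brG n q p := by
  refine G_ext ?_ ?_ ?_ <;> simp [brG]
  abel

theorem brG_add_right (p q q' : G n) : brG n p (q + q') = brG n p q + brG n p q' := by
  rw [brG_skew, brG_add_left, neg_add, ← brG_skew, ← brG_skew]

theorem brG_smul_right (c : ℂ) (p q : G n) : brG n p (c • q) = c • brG n p q := by
  rw [brG_skew p (c • q), brG_smul_left, brG_skew p q, smul_neg]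

theorem brG_neg_left (p q : G n) : brG n (-p) q = -brG n p q := by
  refine G_ext ?_ ?_ ?_ <;> simp [brG, neg_mulVec, mulVec_neg] <;> abel

theorem brG_neg_right (p q : G n) : brG n p (-q) = -brG n p q := by
  rw [brG_skew p (-q), brG_neg_left, brG_skew p q]

theorem brG_sub_left (p p' q : G n) : brG n (p - p') q = brG n p q - brG n p' q := by
  rw [sub_eq_add_neg, brG_add_left, brG_neg_left, sub_eq_add_neg]

@[simp] theorem brG_zero_left (q : G n) : brG n 0 q = 0 := by
  simpa using brG_smul_left 0 0 q

@[simp] theorem brG_zero_right (p : G n) : brG n p 0 = 0 := by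
  simpa using brG_smul_right 0 p 0

theorem brG_jacobi (p q r : G n) :
    brG n p (brG n q r) = brG n (brG n p q) r + brG n q (brG n p r) := by
  refine G_ext ?_ ?_ ?_
  · simp [brG]
  · simp only [brG, Prod.snd_add, Prod.fst_add, Submodule.coe_add]
    noncomm_ring
  · simp only [brG, Prod.snd_add, mulVec_add, mulVec_sub, sub_mulVec, mulVec_smul,
      ← mulVec_mulVec, smul_sub, smul_add, zero_smul]
    module

variable (n) in
/-- The element `A` of `G`, acting as the identity on the odd part. -/
noncomputable def gA : G n := (1, 0, 0)

theorem mem_evenG {p : G n} : p ∈ evenG n ↔ p.2.2 = 0 := Iff.rfl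

theorem mem_oddG {p : G n} : p ∈ oddG n ↔ p.1 = 0 ∧ p.2.1 = 0 := Iff.rfl

theorem gA_mem : gA n ∈ evenG n := rfl

theorem brG_gA_even {p : G n} (hp : p ∈ evenG n) : brG n (gA n) p = 0 := by
  rw [mem_evenG] at hp
  refine G_ext ?_ ?_ ?_ <;> simp [brG, gA, hp]

theorem brG_gA_odd {p : G n} (hp : p ∈ oddG n) : brG n (gA n) p = p := by
  rw [mem_oddG] at hp
  refine G_ext ?_ ?_ ?_ <;> simp [brG, gA, hp]

theorem brG_odd_odd {p q : G n} (hp : p ∈ oddG n) (hq : q ∈ oddG n) : brG n p q = 0 := by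
  rw [mem_oddG] at hp hq
  refine G_ext ?_ ?_ ?_ <;> simp [brG, hp, hq]

theorem brG_even_even {p q : G n} (hp : p ∈ evenG n) (hq : q ∈ evenG n) :
    brG n p q ∈ evenG n := by
  rw [mem_evenG] at *
  simp [brG, hp, hq]

theorem brG_even_odd {p q : G n} (hp : p ∈ evenG n) (hq : q ∈ oddG n) :
    brG n p q ∈ oddG n := by
  rw [mem_evenG] at hp
  rw [mem_oddG] at *
  simp [brG, hp, hq]

theorem exists_even_add_odd (p : G n) : ∃ x ∈ evenG n, ∃ y ∈ oddG n, p = x + y :=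
  ⟨(p.1, p.2.1, 0), rfl, (0, 0, p.2.2), ⟨rfl, rfl⟩, by refine G_ext ?_ ?_ ?_ <;> simp⟩

theorem mk_mem_oddG (v : Fin n → ℂ) : ((0, 0, v) : G n) ∈ oddG n := ⟨rfl, rfl⟩

theorem mk_mem_evenG (s : ℂ) (M : skewS n) : ((s, M, 0) : G n) ∈ evenG n := rfl

theorem brG_mk_even_mk_odd (s : ℂ) (M : skewS n) (v : Fin n → ℂ) :
    brG n (s, M, 0) (0, 0, v) = (0, 0, s • v + M.1 *ᵥ v) := by
  refine G_ext ?_ ?_ ?_ <;> simp [brG]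

theorem eq_mk_of_mem_oddG {p : G n} (hp : p ∈ oddG n) : p = (0, 0, p.2.2) :=
  Prod.ext hp.1 (Prod.ext hp.2 rfl)

/-- The matrix `B_{ij}` as an element of the skew-symmetric matrices. -/
noncomputable def gB (i j : Fin n) : skewS n :=
  ⟨single i j 1 - single j i 1, by
    change (single i j (1 : ℂ) - single j i 1)ᵀ = _
    simp⟩

theorem gB_mulVec (i j : Fin n) (v : Fin n → ℂ) :
    (gB i j).1 *ᵥ v = Pi.single i (v j) - Pi.single j (v i) := by
  simp [gB, sub_mulVec, single_mulVec, Pi.single]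

theorem exists_ne_ne (hn : 3 ≤ n) (i j : Fin n) : ∃ k, k ≠ i ∧ k ≠ j := by
  obtain ⟨k, hk⟩ := Finset.exists_mem_notMem_of_card_lt_card
    (s := {i, j}) (t := (Finset.univ : Finset (Fin n)))
    ((Finset.card_le_two).trans_lt (by rwa [Finset.card_univ, Fintype.card_fin]))
  exact ⟨k, by simpa using hk⟩

/-- The even part acts faithfully on the odd part. -/
theorem eq_zero_of_brG_odd_eq_zero (hn : 3 ≤ n) {p : G n} (hp : p ∈ evenG n)
    (h : ∀ q ∈ oddG n, brG n p q = 0) : p = 0 := by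
  have key : ∀ i j : Fin n, p.2.1.1 i j = -(if i = j then p.1 else 0) := by
    intro i j
    have := congrFun (congrArg (fun x : G n => x.2.2) (h _ (mk_mem_oddG (Pi.single j 1)))) i
    have h' : (if i = j then p.1 else 0) + p.2.1.1 i j = 0 := by
      simpa [brG, Pi.single_apply] using this
    linear_combination h'
  have hskew : ∀ i, p.2.1.1 i i = 0 := by
    intro i
    have : p.2.1.1 i i = -p.2.1.1 i i := congrFun (congrFun p.2.1.2 i) i
    linear_combination this / 2
  have hs : p.1 = 0 := by
    have h0 := key ⟨0, by lia⟩ ⟨0, by lia⟩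
    rw [hskew] at h0
    simpa using h0.symm
  refine G_ext hs ?_ hp
  ext i j
  simp [key, hs]

/-- A vector killed by the derived algebra of the even part is zero. -/
theorem eq_zero_of_brG_brG_eq_zero (hn : 3 ≤ n) {q : G n} (hq : q ∈ oddG n)
    (h : ∀ x ∈ evenG n, ∀ y ∈ evenG n, brG n (brG n x y) q = 0) : q = 0 := by
  rw [eq_mk_of_mem_oddG hq]
  refine G_ext rfl rfl (funext fun j => ?_)
  obtain ⟨i, hi, -⟩ := exists_ne_ne hn j j
  obtain ⟨k, hki, hkj⟩ := exists_ne_ne hn i j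
  have := congrFun (congrArg (fun x : G n => x.2.2)
    (h _ (mk_mem_evenG 0 (gB i k)) _ (mk_mem_evenG 0 (gB k j)))) i
  simpa [brG, sub_mulVec, ← mulVec_mulVec, gB_mulVec, hi, hki, hkj, hi.symm, hki.symm,
    hkj.symm] using this

/-- Schur's lemma for the odd part as a module over the even part. -/
theorem exists_eq_smul_of_commute (hn : 3 ≤ n) (T : G n →ₗ[ℂ] G n)
    (hT : ∀ q ∈ oddG n, T q ∈ oddG n)
    (hc : ∀ p ∈ evenG n, ∀ q ∈ oddG n, T (brG n p q) = brG n p (T q)) :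
    ∃ c : ℂ, ∀ q ∈ oddG n, T q = c • q := by
  let t : (Fin n → ℂ) →ₗ[ℂ] (Fin n → ℂ) :=
    LinearMap.snd ℂ _ _ ∘ₗ LinearMap.snd ℂ _ _ ∘ₗ T ∘ₗ LinearMap.inr ℂ _ _ ∘ₗ
      LinearMap.inr ℂ _ _
  have ht : ∀ v, t v = (T (0, 0, v)).2.2 := fun v => rfl
  have hcomm : ∀ i j v, t ((gB i j).1 *ᵥ v) = (gB i j).1 *ᵥ t v := by
    intro i j v
    have := congrArg (fun x : G n => x.2.2) (hc _ (mk_mem_evenG 0 (gB i j)) _ (mk_mem_oddG v))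
    rw [eq_mk_of_mem_oddG (hT _ (mk_mem_oddG v)), brG_mk_even_mk_odd, brG_mk_even_mk_odd] at this
    simpa only [ht, zero_smul, zero_add] using this
  have hoff : ∀ i k, k ≠ i → t (Pi.single i 1) k = 0 := by
    intro i k hki
    obtain ⟨l, hlk, hli⟩ := exists_ne_ne hn k i
    have := congrFun (hcomm l k (Pi.single i 1)) l
    rw [gB_mulVec, gB_mulVec] at this
    simpa [ hki, hli, hlk] using this.symm
  have hdiag : ∀ i j, i ≠ j → t (Pi.single i 1) i = t (Pi.single j 1) j := by
    intro i j hij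
    have := congrFun (hcomm i j (Pi.single j 1)) i
    rw [gB_mulVec, gB_mulVec] at this
    simpa [ hij] using this
  refine ⟨t (Pi.single ⟨0, by lia⟩ 1) ⟨0, by lia⟩, fun q hq => ?_⟩
  set c := t (Pi.single ⟨0, by lia⟩ 1) ⟨0, by lia⟩
  have htc : t = c • LinearMap.id := by
    refine LinearMap.pi_ext' fun i => LinearMap.ext_ring (funext fun k => ?_)
    rcases eq_or_ne k i with rfl | hki
    · rcases eq_or_ne k ⟨0, by lia⟩ with rfl | hk
      · simp [c]
      · simpa using hdiag _ _ hk
    · simpa [hki] using hoff i k hki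
  rw [eq_mk_of_mem_oddG (hT q hq)]
  refine G_ext (by simp [hq.1]) (by simp [hq.2]) ?_
  have h1 : (T q).2.2 = t q.2.2 := by rw [ht, ← eq_mk_of_mem_oddG hq]
  simp [h1, htc]

end Bracket

@[simp] theorem sgn_zero_left (b : ZMod 2) : sgn ℂ 0 b = 1 := by simp [sgn]

@[simp] theorem sgn_zero_right (a : ZMod 2) : sgn ℂ a 0 = 1 := by simp [sgn]

theorem one_add_one_zmod_two : (1 + 1 : ZMod 2) = 0 := rfl

theorem superBider_degree_zero (hn : 3 ≤ n) (Fb : G n →ₗ[ℂ] G n →ₗ[ℂ] G n)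
    (hgr : ∀ a b : ZMod 2, ∀ p ∈ gradeG n a, ∀ q ∈ gradeG n b,
      Fb p q ∈ gradeG n (a + b))
    (hbd1 : ∀ a b c : ZMod 2, ∀ p ∈ gradeG n a, ∀ q ∈ gradeG n b, ∀ r ∈ gradeG n c,
      Fb p (brG n q r) = brG n (Fb p q) r + (sgn ℂ a b) • brG n q (Fb p r))
    (hbd2 : ∀ a b c : ZMod 2, ∀ p ∈ gradeG n a, ∀ q ∈ gradeG n b, ∀ r ∈ gradeG n c,
      Fb (brG n p q) r = (sgn ℂ c b) • brG n (Fb p r) q + brG n p (Fb q r)) :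
    ∃ lam : ℂ, ∀ p q : G n, Fb p q = lam • brG n p q := by
  have gee : ∀ x ∈ evenG n, ∀ y ∈ evenG n, Fb x y ∈ evenG n := hgr 0 0
  have geo : ∀ x ∈ evenG n, ∀ y ∈ oddG n, Fb x y ∈ oddG n := hgr 0 1
  have goe : ∀ x ∈ oddG n, ∀ y ∈ evenG n, Fb x y ∈ oddG n := hgr 1 0
  have goo : ∀ x ∈ oddG n, ∀ y ∈ oddG n, Fb x y ∈ evenG n := hgr 1 1
  have heA : ∀ x ∈ evenG n, Fb x (gA n) = 0 := by
    refine fun x hx => eq_zero_of_brG_odd_eq_zero hn (gee x hx _ gA_mem) fun c hc => ?_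
    have := hbd1 0 0 1 x hx _ gA_mem c hc
    simpa [brG_gA_odd hc, brG_gA_odd (geo x hx c hc)] using this
  have hAe : ∀ x ∈ evenG n, Fb (gA n) x = 0 := by
    refine fun x hx => eq_zero_of_brG_odd_eq_zero hn (gee _ gA_mem x hx) fun c hc => ?_
    have := hbd2 0 1 0 _ gA_mem c hc x hx
    simpa [brG_gA_odd hc, brG_gA_odd (goe c hc x hx)] using this
  have hoo : ∀ x ∈ oddG n, ∀ y ∈ oddG n, Fb x y = 0 := by
    intro x hx y hy
    have := hbd1 1 0 1 x hx _ gA_mem y hy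
    simpa [brG_gA_odd hy, brG_odd_odd (goe x hx _ gA_mem) hy,
      brG_gA_even (goo x hx y hy)] using this
  obtain ⟨lam, hlam⟩ := exists_eq_smul_of_commute hn (Fb (gA n)) (geo _ gA_mem) (by
    intro p hp q hq
    simpa [hAe p hp] using hbd1 0 0 1 _ gA_mem p hp q hq)
  obtain ⟨mu, hmu⟩ := exists_eq_smul_of_commute hn (Fb.flip (gA n))
    (fun q hq => goe q hq _ gA_mem) (by
      intro p hp q hq
      simpa [heA p hp] using hbd2 0 1 0 p hp q hq _ gA_mem)
  simp only [LinearMap.flip_apply] at hmu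
  have heo : ∀ x ∈ evenG n, ∀ y ∈ oddG n, Fb x y = lam • brG n x y := by
    intro x hx y hy
    have := hbd2 0 0 1 _ gA_mem x hx y hy
    rw [brG_gA_even hx, brG_gA_odd (geo x hx y hy), hlam y hy, brG_smul_left, brG_skew y x] at this
    simp only [map_zero, LinearMap.zero_apply, sgn_zero_right, one_smul, smul_neg] at this
    exact (neg_add_eq_zero.mp this.symm).symm
  have hoe : ∀ x ∈ oddG n, ∀ y ∈ evenG n, Fb x y = -mu • brG n x y := by
    intro x hx y hy
    have := hbd1 1 0 0 x hx _ gA_mem y hy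
    rw [brG_gA_even hy, brG_gA_odd (goe x hx y hy), hmu x hx, brG_smul_left] at this
    simp only [map_zero, sgn_zero_right, one_smul] at this
    linear_combination (norm := module) (-1 : ℂ) • this
  have hee : ∀ x ∈ evenG n, ∀ y ∈ evenG n, Fb x y = lam • brG n x y := by
    intro x hx y hy
    rw [← sub_eq_zero]
    refine eq_zero_of_brG_odd_eq_zero hn
      (Submodule.sub_mem _ (gee x hx y hy) (Submodule.smul_mem _ _ (brG_even_even hx hy)))
      fun c hc => ?_
    have := hbd1 0 0 1 x hx y hy c hc
    rw [heo x hx _ (brG_even_odd hy hc), heo x hx c hc, brG_jacobi, brG_smul_right] at this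
    rw [sgn_zero_left, one_smul, smul_add, add_left_inj] at this
    rw [brG_sub_left, brG_smul_left, this, sub_self]
  have hmul : -mu = lam := by
    by_contra hne
    have hzero : ∀ c ∈ oddG n, c = 0 := by
      refine fun c hc => eq_zero_of_brG_brG_eq_zero hn hc fun x hx y hy => ?_
      have := hbd2 0 1 0 x hx c hc y hy
      rw [hoe _ (brG_even_odd hx hc) y hy, hee x hx y hy, hoe c hc y hy, brG_skew _ y,
        brG_skew c y, brG_smul_left, brG_smul_right, brG_jacobi y, brG_skew y x] at this
      simp only [brG_neg_left, brG_neg_right, sgn_zero_left, one_smul] at this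
      refine (smul_eq_zero.mp ?_).resolve_left (sub_ne_zero.mpr hne)
      linear_combination (norm := module) this
    have := congrFun (congrArg (fun x : G n => x.2.2) (hzero _ (mk_mem_oddG 1))) ⟨0, by lia⟩
    simp at this
  refine ⟨lam, fun p q => ?_⟩
  obtain ⟨x, hx, c, hc, rfl⟩ := exists_even_add_odd p
  obtain ⟨y, hy, d, hd, rfl⟩ := exists_even_add_odd q
  simp only [map_add, LinearMap.add_apply, brG_add_left, brG_add_right, hee x hx y hy,
    heo x hx d hd, hoe c hc y hy, hoo c hc d hd, brG_odd_odd hc hd, hmul, smul_add, smul_zero]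

theorem superBider_degree_one (hn : 3 ≤ n) (Fb : G n →ₗ[ℂ] G n →ₗ[ℂ] G n)
    (hgr : ∀ a b : ZMod 2, ∀ p ∈ gradeG n a, ∀ q ∈ gradeG n b,
      Fb p q ∈ gradeG n (a + b + 1))
    (hbd1 : ∀ a b c : ZMod 2, ∀ p ∈ gradeG n a, ∀ q ∈ gradeG n b, ∀ r ∈ gradeG n c,
      Fb p (brG n q r) = brG n (Fb p q) r + (sgn ℂ (1 + a) b) • brG n q (Fb p r))
    (hbd2 : ∀ a b c : ZMod 2, ∀ p ∈ gradeG n a, ∀ q ∈ gradeG n b, ∀ r ∈ gradeG n c,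
      Fb (brG n p q) r = (sgn ℂ (1 + c) b) • brG n (Fb p r) q + brG n p (Fb q r)) :
    Fb = 0 := by
  have gee : ∀ x ∈ evenG n, ∀ y ∈ evenG n, Fb x y ∈ oddG n := hgr 0 0
  have geo : ∀ x ∈ evenG n, ∀ y ∈ oddG n, Fb x y ∈ evenG n := hgr 0 1
  have goe : ∀ x ∈ oddG n, ∀ y ∈ evenG n, Fb x y ∈ evenG n := hgr 1 0
  have goo : ∀ x ∈ oddG n, ∀ y ∈ oddG n, Fb x y ∈ oddG n := hgr 1 1
  have heA : ∀ x ∈ evenG n, Fb x (gA n) = brG n x (Fb (gA n) (gA n)) := by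
    intro x hx
    have := hbd2 0 0 0 _ gA_mem x hx _ gA_mem
    rw [brG_gA_even hx, brG_gA_odd (gee x hx _ gA_mem), brG_skew _ x] at this
    simp only [map_zero, LinearMap.zero_apply, sgn_zero_right, one_smul] at this
    exact (neg_add_eq_zero.mp this.symm).symm
  have hAe : ∀ x ∈ evenG n, Fb (gA n) x = brG n x (Fb (gA n) (gA n)) := by
    intro x hx
    have := hbd1 0 0 0 _ gA_mem _ gA_mem x hx
    rw [brG_gA_even hx, brG_gA_odd (gee _ gA_mem x hx), brG_skew _ x] at this
    simp only [map_zero, sgn_zero_right, one_smul] at this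
    exact (neg_add_eq_zero.mp this.symm).symm
  have hv : Fb (gA n) (gA n) = 0 := by
    refine eq_zero_of_brG_brG_eq_zero hn (gee _ gA_mem _ gA_mem) fun x hx y hy => ?_
    have h1 := hbd1 0 0 0 x hx _ gA_mem y hy
    have h2 := hbd2 0 0 0 _ gA_mem x hx y hy
    rw [brG_gA_even hy, brG_gA_odd (gee x hx y hy), heA x hx, brG_skew _ y] at h1
    rw [brG_gA_even hx, brG_gA_odd (gee x hx y hy), hAe y hy, brG_skew _ x, brG_jacobi x] at h2
    simp only [map_zero, LinearMap.zero_apply, sgn_zero_right, one_smul] at h1 h2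
    linear_combination (norm := module) h2 - h1
  have heo : ∀ x ∈ evenG n, ∀ y ∈ oddG n, Fb x y = 0 := by
    intro x hx y hy
    have := hbd1 0 0 1 x hx _ gA_mem y hy
    simpa [brG_gA_odd hy, brG_gA_even (geo x hx y hy), heA x hx, hv] using this
  have hoe : ∀ x ∈ oddG n, ∀ y ∈ evenG n, Fb x y = 0 := by
    intro x hx y hy
    have := hbd2 0 1 0 _ gA_mem x hx y hy
    simpa [brG_gA_odd hx, brG_gA_even (goe x hx y hy), hAe y hy, hv] using this
  have hee : ∀ x ∈ evenG n, ∀ y ∈ evenG n, Fb x y = 0 := by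
    intro x hx y hy
    have := hbd1 0 0 0 x hx _ gA_mem y hy
    simpa [brG_gA_even hy, brG_gA_odd (gee x hx y hy), heA x hx, hv] using this.symm
  have hleft : ∀ x ∈ oddG n, ∃ c : ℂ, ∀ y ∈ oddG n, Fb x y = c • y := by
    refine fun x hx => exists_eq_smul_of_commute hn (Fb x) (goo x hx) fun p hp q hq => ?_
    simpa [hoe x hx p hp] using hbd1 1 0 1 x hx p hp q hq
  have hright : ∀ y ∈ oddG n, ∃ c : ℂ, ∀ x ∈ oddG n, Fb x y = c • x := by
    refine fun y hy => exists_eq_smul_of_commute hn (Fb.flip y) (fun x hx => goo x hx y hy)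
      fun p hp q hq => ?_
    simpa [heo p hp y hy, one_add_one_zmod_two] using hbd2 0 1 1 p hp q hq y hy
  have hoo : ∀ x ∈ oddG n, ∀ y ∈ oddG n, Fb x y = 0 := by
    have hne : ∀ i j : Fin n, i ≠ j →
        Fb (0, 0, Pi.single i 1) (0, 0, Pi.single j 1) = 0 := by
      intro i j hij
      obtain ⟨c, hc⟩ := hleft _ (mk_mem_oddG (Pi.single i 1))
      obtain ⟨d, hd⟩ := hright _ (mk_mem_oddG (Pi.single j 1))
      have h := (hc _ (mk_mem_oddG (Pi.single j 1))).symm.trans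
        (hd _ (mk_mem_oddG (Pi.single i 1)))
      have hcz : c = 0 := by
        simpa [hij.symm] using congrFun (congrArg (fun x : G n => x.2.2) h) j
      rw [hc _ (mk_mem_oddG _), hcz, zero_smul]
    have hbasis : ∀ i : Fin n, ∀ y ∈ oddG n, Fb (0, 0, Pi.single i 1) y = 0 := by
      intro i y hy
      obtain ⟨j, hji, -⟩ := exists_ne_ne hn i i
      obtain ⟨c, hc⟩ := hleft _ (mk_mem_oddG (Pi.single i 1))
      have hcz : c = 0 := by
        have h := (hc _ (mk_mem_oddG (Pi.single j 1))).symm.trans (hne i j hji.symm)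
        simpa using congrFun (congrArg (fun x : G n => x.2.2) h) j
      rw [hc y hy, hcz, zero_smul]
    intro x hx y hy
    obtain ⟨d, hd⟩ := hright y hy
    have h := (hd _ (mk_mem_oddG (Pi.single ⟨0, by lia⟩ 1))).symm.trans (hbasis _ y hy)
    have hdz : d = 0 := by
      simpa using congrFun (congrArg (fun x : G n => x.2.2) h) ⟨0, by lia⟩
    rw [hd x hx, hdz, zero_smul]
  refine LinearMap.ext₂ fun p q => ?_
  obtain ⟨x, hx, c, hc, rfl⟩ := exists_even_add_odd p
  obtain ⟨y, hy, d, hd, rfl⟩ := exists_even_add_odd q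
  simp [hee x hx y hy, heo x hx d hd, hoe c hc y hy, hoo c hc d hd]

/-- every superbiderivation `F` of `G` (n ≥ 3) has degree `0` and is
`F(x,y) = λ[x,y]` for some scalar `λ`. -/
theorem superBider_G (hn : 3 ≤ n)
    (dF : ZMod 2) (Fb : G n →ₗ[ℂ] G n →ₗ[ℂ] G n)
    (hgr : ∀ a b : ZMod 2, ∀ p ∈ gradeG n a, ∀ q ∈ gradeG n b,
      Fb p q ∈ gradeG n (a + b + dF))
    (hbd1 : ∀ a b c : ZMod 2, ∀ p ∈ gradeG n a, ∀ q ∈ gradeG n b, ∀ r ∈ gradeG n c,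
      Fb p (brG n q r) = brG n (Fb p q) r + (sgn ℂ (dF + a) b) • brG n q (Fb p r))
    (hbd2 : ∀ a b c : ZMod 2, ∀ p ∈ gradeG n a, ∀ q ∈ gradeG n b, ∀ r ∈ gradeG n c,
      Fb (brG n p q) r = (sgn ℂ (dF + c) b) • brG n (Fb p r) q + brG n p (Fb q r)) :
    (∃ lam : ℂ, ∀ p q : G n, Fb p q = lam • brG n p q) ∧ (dF = 1 → Fb = 0) := by
  obtain rfl | rfl : dF = 0 ∨ dF = 1 :=
    (by decide : ∀ d : ZMod 2, d = 0 ∨ d = 1) dF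
  · simp only [add_zero, zero_add] at hgr hbd1 hbd2
    exact ⟨superBider_degree_zero n hn Fb hgr hbd1 hbd2, fun h => absurd h (by decide)⟩
  · have h := superBider_degree_one n hn Fb hgr hbd1 hbd2
    exact ⟨⟨0, fun p q => by simp [h]⟩, fun _ => h⟩

end SuperBider
end

section
/- Let G be the superderivation algebra of the (n+1)-dimensional Heisenberg superalgebra with n ≥ 3. A linear map f : G → G is supercommuting (i.e., [f(x),y] = [x,f(y)] for all x,y) if and only if f = λ·id for some scalar λ. -/
namespace SuperBider

open Matrix

variable (n : ℕ)

theorem skewS_diag_eq_zero {M : Matrix (Fin n) (Fin n) ℂ} (hM : M ∈ skewS n) (i : Fin n) :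
    M i i = 0 := by
  have h : M i i = -M i i := congrFun (congrFun (show Mᵀ = -M from hM) i) i
  exact self_eq_neg.mp h

/-- The elementary skew matrix `e_{ij} - e_{ji}`. -/
def elemSkew (i j : Fin n) : skewS n :=
  ⟨Matrix.single i j 1 - Matrix.single j i 1, by
    show (Matrix.single i j (1 : ℂ) - Matrix.single j i 1)ᵀ = -_
    simp [Matrix.transpose_sub]⟩

/-- The centre of the Lie algebra of skew matrices of size at least three is trivial. -/
theorem eq_zero_of_commute_skewS (hn : 3 ≤ n) {M : Matrix (Fin n) (Fin n) ℂ}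
    (hM : M ∈ skewS n) (hc : ∀ N ∈ skewS n, M * N - N * M = 0) : M = 0 := by
  ext i j
  by_cases hij : i = j
  · subst hij
    exact skewS_diag_eq_zero n hM i
  obtain ⟨k, hki, hkj⟩ : ∃ k, k ≠ i ∧ k ≠ j := by
    obtain ⟨k, -, hk⟩ := Finset.exists_mem_notMem_of_card_lt_card
      (s := {i, j}) (t := (Finset.univ : Finset (Fin n)))
      (Finset.card_le_two.trans_lt (by simpa using Nat.lt_of_succ_le hn))
    exact ⟨k, by simpa using hk⟩
  have h := congrFun (congrFun (hc _ (elemSkew n j k).2) i) k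
  simpa [elemSkew, mul_sub, sub_mul, hij, hki, hki.symm, hkj, hkj.symm] using h

theorem skew_add_scalar_eq_zero {M : Matrix (Fin n) (Fin n) ℂ} (hM : M ∈ skewS n) (hn : 0 < n)
    {c : ℂ} (h : ∀ w : Fin n → ℂ, c • w + M *ᵥ w = 0) : c = 0 ∧ M = 0 := by
  have key : ∀ i j, c * (Pi.single j 1 : Fin n → ℂ) i + M i j = 0 := fun i j => by
    simpa using congrFun (h (Pi.single j 1)) i
  have hc : c = 0 := by
    simpa [skewS_diag_eq_zero n hM] using key ⟨0, hn⟩ ⟨0, hn⟩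
  exact ⟨hc, by ext i j; simpa [hc] using key i j⟩

/-- a linear map `f` on `G` (n ≥ 3) is supercommuting,
i.e. `[f(x),y] = [x,f(y)]` for all `x,y`, iff `f = λ·id` for some scalar `λ`. -/
theorem supercommuting_G (hn : 3 ≤ n)
    (f : G n →ₗ[ℂ] G n) :
    (∀ p q : G n, brG n (f p) q = brG n p (f q)) ↔
      ∃ lam : ℂ, f = lam • (LinearMap.id : G n →ₗ[ℂ] G n) := by
  constructor
  · intro h
    have hmat : ∀ p q : G n, (f p).2.1.1 * q.2.1.1 - q.2.1.1 * (f p).2.1.1 =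
        p.2.1.1 * (f q).2.1.1 - (f q).2.1.1 * p.2.1.1 := fun p q =>
      congrArg (fun x : G n => x.2.1.1) (h p q)
    have hvec : ∀ p q : G n,
        (f p).1 • q.2.2 - q.1 • (f p).2.2 + (f p).2.1.1 *ᵥ q.2.2 - q.2.1.1 *ᵥ (f p).2.2 =
        p.1 • (f q).2.2 - (f q).1 • p.2.2 + p.2.1.1 *ᵥ (f q).2.2 - (f q).2.1.1 *ᵥ p.2.2 :=
      fun p q => congrArg (fun x : G n => x.2.2) (h p q)
    have hcentral : ∀ p : G n, p.2.1 = 0 → (f p).2.1.1 = 0 := fun p hp =>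
      eq_zero_of_commute_skewS n hn (f p).2.1.2 fun N hN => by
        simpa [hp] using hmat p (0, ⟨N, hN⟩, 0)
    let A : G n := (1, 0, 0)
    have hA : (f A).2.2 = 0 := by
      have := hvec A A
      simp only [A, smul_zero, one_smul, mulVec_zero, zero_sub, sub_zero, add_zero,
        ZeroMemClass.coe_zero, zero_mulVec] at this
      exact self_eq_neg.mp this.symm
    have hodd : ∀ q : G n, (f q).2.2 = (f A).1 • q.2.2 := fun q => by
      have := hvec A q
      rw [hA, hcentral A rfl] at this
      simpa [A] using this.symm
    have hC : ∀ w : Fin n → ℂ, (f (0, 0, w)).1 = 0 := fun w => by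
      by_cases hw : w = 0
      · have h0 : ((0, 0, w) : G n) = 0 := by rw [hw]; rfl
        rw [h0, map_zero]; rfl
      · have := hvec (0, 0, w) (0, 0, w)
        rw [hcentral _ rfl] at this
        have h2 : (f (0, 0, w)).1 • w = 0 := self_eq_neg.mp (by simpa using this)
        exact (smul_eq_zero.mp h2).resolve_right hw
    refine ⟨(f A).1, LinearMap.ext fun q => ?_⟩
    have hq := skew_add_scalar_eq_zero n
      (M := (f q).2.1.1 - (f A).1 • q.2.1.1) (c := (f q).1 - (f A).1 * q.1)
      ((skewS n).sub_mem (f q).2.1.2 ((skewS n).smul_mem _ q.2.1.2)) (by omega) fun w => by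
        have := hvec (0, 0, w) q
        rw [hcentral _ rfl, hC, hodd (0, 0, w)] at this
        simp only [zero_smul, zero_mulVec, zero_sub, add_zero, ZeroMemClass.coe_zero,
          mulVec_smul] at this
        rw [sub_mulVec, smul_mulVec, sub_smul, mul_comm, mul_smul]
        linear_combination this
    exact Prod.ext (sub_eq_zero.mp hq.1)
      (Prod.ext (Subtype.ext (sub_eq_zero.mp hq.2)) (hodd q))
  · rintro ⟨lam, rfl⟩ p q
    refine Prod.ext rfl (Prod.ext (Subtype.ext ?_) ?_)
    · simp [brG]
    · simp [brG, smul_mulVec, mulVec_smul, mul_smul, smul_comm lam]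

end SuperBider
end
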